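/- Let H be a unit-cancellative monoid. Every atom of H is a quark for the divisibility preorder ∣_H, i.e., if a is an atom then there is no non-unit b ∈ H with b ∣_H a and a ∤_H b. -/

import Mathlib

theorem stmt_9 {H : Type*} [Monoid H]
    (huc : ∀ x y : H, ¬ IsUnit y → x * y ≠ x ∧ y * x ≠ x) (a : H)
    (ha : ¬ IsUnit a ∧ ∀ x y : H, ¬ IsUnit x → ¬ IsUnit y → a ≠ x * y) :
    ¬ ∃ b : H, ¬ IsUnit b ∧ (∃ u v : H, a = u * b * v) ∧
      ¬ (∃ u v : H, b = u * a * v) := by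
  rintro ⟨b, hb, ⟨u, v, hab⟩, hn⟩
  have df : ∀ x y : H, x * y = 1 → y * x = 1 := by
    intro x y h
    have hu : IsUnit (y * x) := by
      by_contra hc
      exact (huc y (y * x) hc).2 (by rw [mul_assoc, h, mul_one])
    apply hu.mul_left_cancel
    rw [mul_one, mul_assoc, ← mul_assoc x, h, one_mul]
  have hub : ¬ IsUnit (u * b) := by
    rintro ⟨w, hw⟩
    have h1 : ((w⁻¹ : Hˣ) : H) * u * b = 1 := by
      rw [mul_assoc, ← hw, Units.inv_mul]
    exact hb ⟨⟨b, _, df _ _ h1, h1⟩, rfl⟩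
  have hv : IsUnit v := by
    by_contra hv
    exact ha.2 _ _ hub hv hab
  obtain ⟨v, rfl⟩ := hv
  have hu : IsUnit u := by
    by_contra hu
    refine ha.2 u (b * v) hu ?_ (by rw [hab, mul_assoc])
    rwa [Units.isUnit_mul_units]
  obtain ⟨u, rfl⟩ := hu
  exact hn ⟨((u⁻¹ : Hˣ) : H), ((v⁻¹ : Hˣ) : H), by simp [hab, mul_assoc]⟩
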